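/- Suppose the positive integer sequences (m_k), (n_k) satisfy Keane's conditions and that \bar A_{m_1,n_1}\cdots\bar A_{m_k,n_k}(e_2) converges as k → ∞ to a vector u. Then for every k ≥ 1 and every vector v ∈ ℝ⁴ with nonnegative entries satisfying B_k v = u, one has v_2/|v|_1 ≥ 1/3. -/

import Mathlib

open MeasureTheory Filter Set Matrix Topology

noncomputable section

/-- Keane's 4×4 matrix `A_{m,n}` with rows (0,0,1,1), (m−1,m,0,0), (n,n,n−1,n), (1,1,1,1). -/
def Amat (m n : ℕ) : Matrix (Fin 4) (Fin 4) ℝ :=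
  !![0, 0, 1, 1;
     (m : ℝ) - 1, (m : ℝ), 0, 0;
     (n : ℝ), (n : ℝ), (n : ℝ) - 1, (n : ℝ);
     1, 1, 1, 1]

/-- `B_k = A_{m_1,n_1} A_{m_2,n_2} ⋯ A_{m_k,n_k}` (sequences indexed from 1). -/
def Bmat (m n : ℕ → ℕ) (k : ℕ) : Matrix (Fin 4) (Fin 4) ℝ :=
  ((List.range k).map fun i => Amat (m (i + 1)) (n (i + 1))).prod

/-- `|v|₁`, the sum of the absolute values of the entries of `v`. -/
def l1norm (v : Fin 4 → ℝ) : ℝ := ∑ i, |v i|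

/-- `b_{k,i} = |B_k e_i|₁`; here columns are indexed from 0, so `e_i` is the
basis vector with a 1 in position `i` where `i : Fin 4` (e.g. the paper's `e_2` is `i = 1`). -/
def bnum (m n : ℕ → ℕ) (k : ℕ) (i : Fin 4) : ℝ := l1norm fun j => Bmat m n k j i

/-- `Ā_{m,n}(v) = A_{m,n} v / |A_{m,n} v|₁`. -/
def Abar (m n : ℕ) (v : Fin 4 → ℝ) : Fin 4 → ℝ :=
  (l1norm (Amat m n *ᵥ v))⁻¹ • (Amat m n *ᵥ v)

/-- `barSeq m n k v = Ā_{m_1,n_1} Ā_{m_2,n_2} ⋯ Ā_{m_k,n_k} (v)`. -/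
def barSeq (m n : ℕ → ℕ) : ℕ → (Fin 4 → ℝ) → Fin 4 → ℝ
  | 0, v => v
  | k + 1, v => barSeq m n k (Abar (m (k + 1)) (n (k + 1)) v)

/-- The paper's `e₂ = (0,1,0,0)ᵀ`. -/
def e2 : Fin 4 → ℝ := ![0, 1, 0, 0]

/-- The paper's `e₃ = (0,0,1,0)ᵀ`. -/
def e3 : Fin 4 → ℝ := ![0, 0, 1, 0]

/-- Keane's conditions: the sequences are positive integers, `3(n_k+1) ≤ m_k ≤ (n_{k+1}+1)/2`
for all `k ≥ 1`, and `n_1 ≥ 10`. -/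
def KeaneCond (m n : ℕ → ℕ) : Prop :=
  (∀ k, 1 ≤ k → 1 ≤ m k ∧ 1 ≤ n k) ∧
  (∀ k, 1 ≤ k → 3 * (n k + 1) ≤ m k ∧ 2 * m k ≤ n (k + 1) + 1) ∧
  10 ≤ n 1

/-- The permutation (4213) (one-indexed: π(1)=4, π(2)=2, π(3)=1, π(4)=3), written zero-indexed. -/
def kperm : Fin 4 → Fin 4 := ![3, 1, 0, 2]

/-- The 4-interval exchange transformation with length vector `l` and permutation (4213):
on `I_j = [l_1+⋯+l_{j−1}, l_1+⋯+l_j)` it is `x ↦ x − ∑_{k<j} l_k + ∑_{π(k')<π(j)} l_{k'}`. -/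
def iet (l : Fin 4 → ℝ) (x : ℝ) : ℝ :=
  if x < l 0 then
    x + ∑ k ∈ Finset.univ.filter (fun k => kperm k < kperm 0), l k
  else if x < l 0 + l 1 then
    x - l 0 + ∑ k ∈ Finset.univ.filter (fun k => kperm k < kperm 1), l k
  else if x < l 0 + l 1 + l 2 then
    x - (l 0 + l 1) + ∑ k ∈ Finset.univ.filter (fun k => kperm k < kperm 2), l k
  else
    x - (l 0 + l 1 + l 2) + ∑ k ∈ Finset.univ.filter (fun k => kperm k < kperm 3), l k

/-- The IET regarded as a self-map of `ℝ`, extended by the identity off `[0,1)`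
(a measure `μ` with `μ [0,1) = 1` then plays the role of a Borel measure on `[0,1)`). -/
def ietFull (l : Fin 4 → ℝ) (x : ℝ) : ℝ :=
  if x ∈ Set.Ico (0 : ℝ) 1 then iet l x else x

/-- The cone of nonnegative vectors whose second entry is at least a third of their sum. -/
def dominantCone : Set (Fin 4 → ℝ) :=
  {x | (∀ i, 0 ≤ x i) ∧ ∑ i, x i ≤ 3 * x 1}

lemma isClosed_dominantCone : IsClosed dominantCone := by
  have h : dominantCone = (⋂ i, {x : Fin 4 → ℝ | 0 ≤ x i}) ∩ {x | ∑ i, x i ≤ 3 * x 1} := by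
    ext x
    simp [dominantCone]
  rw [h]
  exact (isClosed_iInter fun i => isClosed_le continuous_const (continuous_apply i)).inter
    (isClosed_le (by fun_prop) (by fun_prop))

lemma l1norm_of_nonneg {x : Fin 4 → ℝ} (hx : ∀ i, 0 ≤ x i) : l1norm x = ∑ i, x i :=
  Finset.sum_congr rfl fun i _ => abs_of_nonneg (hx i)

lemma l1norm_nonneg (x : Fin 4 → ℝ) : 0 ≤ l1norm x :=
  Finset.sum_nonneg fun i _ => abs_nonneg (x i)

lemma continuous_l1norm : Continuous l1norm := by
  unfold l1norm
  fun_prop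

lemma smul_mem_dominantCone {c : ℝ} (hc : 0 ≤ c) {x : Fin 4 → ℝ} (hx : x ∈ dominantCone) :
    c • x ∈ dominantCone := by
  refine ⟨fun i => mul_nonneg hc (hx.1 i), ?_⟩
  have h := mul_le_mul_of_nonneg_left hx.2 hc
  simp only [Pi.smul_apply, smul_eq_mul, ← Finset.mul_sum]
  linarith

lemma Amat_mulVec (m n : ℕ) (x : Fin 4 → ℝ) :
    Amat m n *ᵥ x = ![x 2 + x 3, (m - 1) * x 0 + m * x 1,
      n * x 0 + n * x 1 + (n - 1) * x 2 + n * x 3, x 0 + x 1 + x 2 + x 3] := by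
  ext i
  fin_cases i <;> simp [Amat, Matrix.mulVec, dotProduct, Fin.sum_univ_four]

lemma Amat_mulVec_mem_dominantCone {m n : ℕ} (hn : 1 ≤ n) (hm : 3 * (n + 1) ≤ m)
    {x : Fin 4 → ℝ} (hx : x ∈ dominantCone) : Amat m n *ᵥ x ∈ dominantCone := by
  obtain ⟨h0, h1⟩ := hx
  have hn' : (1 : ℝ) ≤ n := by exact_mod_cast hn
  have hm' : 3 * ((n : ℝ) + 1) ≤ m := by exact_mod_cast hm
  have hm1 : (0 : ℝ) ≤ (m : ℝ) - 1 := by linarith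
  have hn1 : (0 : ℝ) ≤ (n : ℝ) - 1 := by linarith
  have x0 := h0 0
  have x1 := h0 1
  have x2 := h0 2
  have x3 := h0 3
  rw [Fin.sum_univ_four] at h1
  rw [Amat_mulVec]
  constructor
  · intro i
    fin_cases i <;> simp <;> positivity
  · simp only [Fin.sum_univ_four, Matrix.cons_val]
    have ha : 3 * ((n : ℝ) + 1) * x 1 ≤ m * x 1 := by gcongr
    have hb : ((n : ℝ) + 1) * (x 0 + x 1 + x 2 + x 3) ≤ (n + 1) * (3 * x 1) := by gcongr
    have hc : 0 ≤ ((m : ℝ) - 1) * x 0 := by positivity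
    have hd : 0 ≤ (n : ℝ) * (x 0 + x 1 + x 2 + x 3) := by positivity
    linarith

lemma l1norm_Abar {m n : ℕ} {x : Fin 4 → ℝ} (hx : ∀ i, 0 ≤ x i) (h : l1norm x = 1) :
    l1norm (Abar m n x) = 1 := by
  have h3 : (Amat m n *ᵥ x) 3 = 1 := by
    rw [Amat_mulVec, ← h, l1norm_of_nonneg hx, Fin.sum_univ_four]
    simp
  have hle : |(Amat m n *ᵥ x) 3| ≤ l1norm (Amat m n *ᵥ x) :=
    Finset.single_le_sum (f := fun i => |(Amat m n *ᵥ x) i|) (fun i _ => abs_nonneg _)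
      (Finset.mem_univ 3)
  rw [h3, abs_one] at hle
  have hpos : 0 < l1norm (Amat m n *ᵥ x) := by linarith
  have hsmul : ∀ c : ℝ, ∀ y : Fin 4 → ℝ, l1norm (c • y) = |c| * l1norm y := fun c y => by
    simp [l1norm, abs_mul, Finset.mul_sum]
  rw [Abar, hsmul, abs_of_pos (inv_pos.2 hpos), inv_mul_cancel₀ hpos.ne']

lemma Abar_mem_dominantCone {m n : ℕ} (hn : 1 ≤ n) (hm : 3 * (n + 1) ≤ m)
    {x : Fin 4 → ℝ} (hx : x ∈ dominantCone) : Abar m n x ∈ dominantCone :=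
  smul_mem_dominantCone (inv_nonneg.2 (l1norm_nonneg _)) (Amat_mulVec_mem_dominantCone hn hm hx)

lemma l1norm_barSeq {m n : ℕ → ℕ} (hK : KeaneCond m n) (k : ℕ) {x : Fin 4 → ℝ}
    (hx : x ∈ dominantCone) (h : l1norm x = 1) : l1norm (barSeq m n k x) = 1 := by
  induction k generalizing x with
  | zero => exact h
  | succ k ih =>
    exact ih (Abar_mem_dominantCone (hK.1 _ k.succ_pos).2 (hK.2.1 _ k.succ_pos).1 hx)
      (l1norm_Abar hx.1 h)

lemma exists_barSeq_add_eq {m n : ℕ → ℕ} (hK : KeaneCond m n) (k j : ℕ) {x : Fin 4 → ℝ}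
    (hx : x ∈ dominantCone) : ∃ y ∈ dominantCone, barSeq m n (k + j) x = barSeq m n k y := by
  induction j generalizing x with
  | zero => exact ⟨x, hx, rfl⟩
  | succ j ih =>
    exact ih (Abar_mem_dominantCone (hK.1 _ (k + j).succ_pos).2
      (hK.2.1 _ (k + j).succ_pos).1 hx)

lemma Bmat_succ (m n : ℕ → ℕ) (k : ℕ) :
    Bmat m n (k + 1) = Bmat m n k * Amat (m (k + 1)) (n (k + 1)) := by
  simp [Bmat, List.range_succ]

lemma exists_barSeq_eq_Bmat_mulVec (m n : ℕ → ℕ) (k : ℕ) (x : Fin 4 → ℝ) :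
    ∃ c : ℝ, 0 ≤ c ∧ barSeq m n k x = Bmat m n k *ᵥ (c • x) := by
  induction k generalizing x with
  | zero => exact ⟨1, zero_le_one, by simp [barSeq, Bmat]⟩
  | succ k ih =>
    obtain ⟨c, hc, h⟩ := ih (Abar (m (k + 1)) (n (k + 1)) x)
    refine ⟨c * (l1norm (Amat (m (k + 1)) (n (k + 1)) *ᵥ x))⁻¹,
      mul_nonneg hc (inv_nonneg.2 (l1norm_nonneg _)), ?_⟩
    rw [barSeq, h, Bmat_succ, ← Matrix.mulVec_mulVec, Abar, smul_smul, Matrix.mulVec_smul _ _ x]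

lemma isUnit_Amat_det (m n : ℕ) : IsUnit (Amat m n).det := by
  have h : (Amat m n).det = 1 := by
    simp [Amat, Matrix.det_succ_row_zero, Fin.sum_univ_succ, Fin.succAbove]
    ring
  simp [h]

lemma isUnit_Bmat_det (m n : ℕ → ℕ) (k : ℕ) : IsUnit (Bmat m n k).det := by
  induction k with
  | zero => simp [Bmat]
  | succ k ih =>
    rw [Bmat_succ, Matrix.det_mul]
    exact ih.mul (isUnit_Amat_det _ _)

lemma e2_mem_dominantCone : e2 ∈ dominantCone := by
  constructor
  · intro i
    fin_cases i <;> simp [e2]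
  · simp only [e2, Fin.sum_univ_four, Matrix.cons_val]
    norm_num

lemma l1norm_e2 : l1norm e2 = 1 := by
  simp [l1norm, e2, Fin.sum_univ_four]

/-- Lemma 2 of Keane: if `B_k v = u` with `v ≥ 0` (so the entries of `v` are the `λ₂`-measures
of the subintervals of the `k`-th induced interval), then `v₂/|v|₁ ≥ 1/3`. -/
theorem lemma_two (m n : ℕ → ℕ) (hK : KeaneCond m n)
    (u : Fin 4 → ℝ)
    (hconv : Tendsto (fun k => barSeq m n k e2) atTop (𝓝 u)) :
    ∀ k, 1 ≤ k → ∀ v : Fin 4 → ℝ, (∀ i, 0 ≤ v i) → Bmat m n k *ᵥ v = u →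
      (1 : ℝ) / 3 ≤ v 1 / l1norm v := by
  intro k _ v hv hBv
  have hinv : (Bmat m n k)⁻¹ * Bmat m n k = 1 := Matrix.nonsing_inv_mul _ (isUnit_Bmat_det m n k)
  have hu : l1norm u = 1 := by
    refine tendsto_nhds_unique ((continuous_l1norm.tendsto u).comp hconv) ?_
    exact tendsto_const_nhds.congr fun K => (l1norm_barSeq hK K e2_mem_dominantCone l1norm_e2).symm
  have hlim : Tendsto (fun j => (Bmat m n k)⁻¹ *ᵥ barSeq m n (k + j) e2) atTop (𝓝 v) := by
    have hcont : Continuous fun x : Fin 4 → ℝ => (Bmat m n k)⁻¹ *ᵥ x := by fun_prop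
    have hv' : (Bmat m n k)⁻¹ *ᵥ u = v := by
      rw [← hBv, Matrix.mulVec_mulVec, hinv, Matrix.one_mulVec]
    rw [← hv']
    exact (hcont.tendsto u).comp
      (hconv.comp (tendsto_atTop_mono (fun j => Nat.le_add_left j k) tendsto_id))
  have hmem : v ∈ dominantCone := by
    refine isClosed_dominantCone.mem_of_tendsto hlim (Eventually.of_forall fun j => ?_)
    obtain ⟨y, hy, h⟩ := exists_barSeq_add_eq hK k j e2_mem_dominantCone
    obtain ⟨c, hc, h'⟩ := exists_barSeq_eq_Bmat_mulVec m n k y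
    rw [h, h', Matrix.mulVec_mulVec, hinv, Matrix.one_mulVec]
    exact smul_mem_dominantCone hc hy
  have hpos : 0 < l1norm v := by
    refine (l1norm_nonneg v).lt_of_ne' fun h0 => ?_
    have hv0 : v = 0 := by
      ext i
      have := (Finset.sum_eq_zero_iff_of_nonneg fun i _ => abs_nonneg (v i)).1 h0 i
        (Finset.mem_univ i)
      simpa using this
    rw [← hBv, hv0, Matrix.mulVec_zero] at hu
    simp [l1norm] at hu
  rw [le_div_iff₀ hpos, l1norm_of_nonneg hv]
  linarith [hmem.2]
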